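/- The evaluation function of the call-by-value λ-calculus is a well-defined partial function: if a program e reduces by the reflexive-transitive closure of standard reduction to values v₁ and v₂, then v₁ = v₂. -/

import Mathlib

/-! # Core definitions: call-by-value λ-calculus, CEK, CESK*, timed and
abstract machines, and garbage collection machinery. -/

/-! ## Syntax -/

inductive Exp : Type where
  | var : ℕ → Exp
  | app : Exp → Exp → Exp
  | lam : ℕ → Exp → Exp
deriving DecidableEq

/-- Values are λ-abstractions. -/
def IsValue (e : Exp) : Prop := ∃ x b, e = Exp.lam x b

/-- Free variables. -/
def fv : Exp → Finset ℕ
  | Exp.var x => {x}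
  | Exp.app e₁ e₂ => fv e₁ ∪ fv e₂
  | Exp.lam x b => fv b \ {x}

/-- A program is a closed expression. -/
def Closed (e : Exp) : Prop := fv e = ∅

/-- Substitution `[v/x]e` (capture-avoiding when `v` is closed, as it is
in call-by-value evaluation of programs). -/
def subst (v : Exp) (x : ℕ) : Exp → Exp
  | Exp.var y => if y = x then v else Exp.var y
  | Exp.app e₁ e₂ => Exp.app (subst v x e₁) (subst v x e₂)
  | Exp.lam y b => if y = x then Exp.lam y b else Exp.lam y (subst v x b)

/-- All variables occurring in an expression (free or bound). -/
def vars : Exp → Finset ℕ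
  | Exp.var x => {x}
  | Exp.app e₁ e₂ => vars e₁ ∪ vars e₂
  | Exp.lam x b => insert x (vars b)

/-- All subexpressions of an expression. -/
def subExps : Exp → Finset Exp
  | Exp.var x => {Exp.var x}
  | Exp.app e₁ e₂ => insert (Exp.app e₁ e₂) (subExps e₁ ∪ subExps e₂)
  | Exp.lam x b => insert (Exp.lam x b) (subExps b)

/-! ## Reduction semantics -/

/-- Evaluation contexts `E ::= [] | (E e) | (v E)`. -/
inductive Ctx : Type where
  | hole : Ctx
  | appL : Ctx → Exp → Ctx
  | appR : Exp → Ctx → Ctx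

/-- Well-formed evaluation contexts: in `(v E)` the left part is a value. -/
inductive ECtx : Ctx → Prop where
  | hole : ECtx Ctx.hole
  | appL : ∀ (E : Ctx) (e : Exp), ECtx E → ECtx (Ctx.appL E e)
  | appR : ∀ (v : Exp) (E : Ctx), IsValue v → ECtx E → ECtx (Ctx.appR v E)

/-- Plugging an expression into the hole of a context. -/
def plug : Ctx → Exp → Exp
  | Ctx.hole, e => e
  | Ctx.appL E e', e => Exp.app (plug E e) e'
  | Ctx.appR v E, e => Exp.app v (plug E e)

/-- The standard call-by-value reduction relation `E[(λx.b) v] ↦ E[[v/x]b]`. -/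
inductive StdStep : Exp → Exp → Prop where
  | mk : ∀ (E : Ctx) (x : ℕ) (b v : Exp), ECtx E → IsValue v →
      StdStep (plug E (Exp.app (Exp.lam x b) v)) (plug E (subst v x b))

/-! ## Association-list finite maps -/

/-- Lookup in an association list. -/
def lookupA {β : Type} (ρ : List (ℕ × β)) (x : ℕ) : Option β :=
  (ρ.find? (fun p => p.1 == x)).map Prod.snd

/-- Finite-map update `ρ[x ↦ b]`. -/
def updA {β : Type} (ρ : List (ℕ × β)) (x : ℕ) (b : β) : List (ℕ × β) :=
  (x, b) :: ρ.filter (fun p => p.1 != x)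

/-- Removing a binding (used for shadowing under a binder). -/
def eraseA {β : Type} (ρ : List (ℕ × β)) (x : ℕ) : List (ℕ × β) :=
  ρ.filter (fun p => p.1 != x)

/-! ## The CEK machine -/

/-- Closures: a value paired with an environment. -/
inductive Clo : Type where
  | mk : Exp → List (ℕ × Clo) → Clo

/-- CEK environments map variables to closures. -/
abbrev CEnv : Type := List (ℕ × Clo)

/-- CEK continuations `κ ::= mt | ar(e,ρ,κ) | fn(v,ρ,κ)`. -/
inductive CKont : Type where
  | mt : CKont
  | ar : Exp → CEnv → CKont → CKont
  | fn : Exp → CEnv → CKont → CKont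

structure CEKState : Type where
  exp : Exp
  env : CEnv
  kont : CKont

/-- The CEK transition relation. -/
inductive CEKStep : CEKState → CEKState → Prop where
  | var : ∀ (x : ℕ) (ρ : CEnv) (κ : CKont) (v : Exp) (ρ' : CEnv),
      lookupA ρ x = some (Clo.mk v ρ') →
      CEKStep ⟨Exp.var x, ρ, κ⟩ ⟨v, ρ', κ⟩
  | app : ∀ (e₀ e₁ : Exp) (ρ : CEnv) (κ : CKont),
      CEKStep ⟨Exp.app e₀ e₁, ρ, κ⟩ ⟨e₀, ρ, CKont.ar e₁ ρ κ⟩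
  | ar : ∀ (v : Exp) (ρ : CEnv) (e : Exp) (ρ' : CEnv) (κ : CKont),
      IsValue v →
      CEKStep ⟨v, ρ, CKont.ar e ρ' κ⟩ ⟨e, ρ', CKont.fn v ρ κ⟩
  | fn : ∀ (v : Exp) (ρ : CEnv) (x : ℕ) (e : Exp) (ρ' : CEnv) (κ : CKont),
      IsValue v →
      CEKStep ⟨v, ρ, CKont.fn (Exp.lam x e) ρ' κ⟩ ⟨e, updA ρ' x (Clo.mk v ρ), κ⟩

/-- Initial CEK state. -/
def injCEK (e : Exp) : CEKState := ⟨e, [], CKont.mt⟩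

/-- `RealR v ρ e'` : performing the delayed substitutions recorded in `ρ`
on `v` yields `e'` (the `real` function, as a relation). -/
inductive RealR : Exp → CEnv → Exp → Prop where
  | varHit : ∀ (x : ℕ) (ρ : CEnv) (v : Exp) (ρ' : CEnv) (e' : Exp),
      lookupA ρ x = some (Clo.mk v ρ') → RealR v ρ' e' → RealR (Exp.var x) ρ e'
  | varMiss : ∀ (x : ℕ) (ρ : CEnv),
      lookupA ρ x = none → RealR (Exp.var x) ρ (Exp.var x)
  | app : ∀ (e₀ e₁ : Exp) (ρ : CEnv) (e₀' e₁' : Exp),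
      RealR e₀ ρ e₀' → RealR e₁ ρ e₁' →
      RealR (Exp.app e₀ e₁) ρ (Exp.app e₀' e₁')
  | lam : ∀ (x : ℕ) (b : Exp) (ρ : CEnv) (b' : Exp),
      RealR b (eraseA ρ x) b' → RealR (Exp.lam x b) ρ (Exp.lam x b')

/-! ## The CESK* machine (generic in the type of addresses) -/

/-- Environments mapping variables to addresses. -/
abbrev PEnv (A : Type) : Type := List (ℕ × A)

/-- Continuations with store pointers `κ ::= mt | ar(e,ρ,a) | fn(v,ρ,a)`. -/
inductive Kont (A : Type) : Type where
  | mt : Kont A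
  | ar : Exp → PEnv A → A → Kont A
  | fn : Exp → PEnv A → A → Kont A

/-- Storable values: closures and continuations. -/
inductive Storable (A : Type) : Type where
  | clo : Exp → PEnv A → Storable A
  | kont : Kont A → Storable A

/-- Stores: partial maps from addresses to storables. -/
abbrev Store (A : Type) : Type := A → Option (Storable A)

/-- Store update `σ[b ↦ s]`. -/
def Store.upd {A : Type} [DecidableEq A] (σ : Store A) (b : A) (s : Storable A) : Store A :=
  fun a => if a = b then some s else σ a

structure CeskState (A : Type) : Type where
  exp : Exp
  env : PEnv A
  sto : Store A
  kptr : A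

/-- The CESK* transition relation (the fresh address `b` with `σ b = none`
is chosen nondeterministically; `κ = σ(a)` is the current continuation). -/
inductive CeskStep {A : Type} [DecidableEq A] : CeskState A → CeskState A → Prop where
  | var : ∀ (x : ℕ) (ρ : PEnv A) (σ : Store A) (a : A) (κ : Kont A) (l : A)
      (v : Exp) (ρ' : PEnv A),
      σ a = some (Storable.kont κ) →
      lookupA ρ x = some l → σ l = some (Storable.clo v ρ') →
      CeskStep ⟨Exp.var x, ρ, σ, a⟩ ⟨v, ρ', σ, a⟩
  | app : ∀ (e₀ e₁ : Exp) (ρ : PEnv A) (σ : Store A) (a : A) (κ : Kont A) (b : A),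
      σ a = some (Storable.kont κ) → σ b = none →
      CeskStep ⟨Exp.app e₀ e₁, ρ, σ, a⟩
        ⟨e₀, ρ, Store.upd σ b (Storable.kont (Kont.ar e₁ ρ a)), b⟩
  | ar : ∀ (v : Exp) (ρ : PEnv A) (σ : Store A) (a : A) (e : Exp) (ρ' : PEnv A)
      (c : A) (b : A),
      IsValue v → σ a = some (Storable.kont (Kont.ar e ρ' c)) → σ b = none →
      CeskStep ⟨v, ρ, σ, a⟩
        ⟨e, ρ', Store.upd σ b (Storable.kont (Kont.fn v ρ c)), b⟩
  | fn : ∀ (v : Exp) (ρ : PEnv A) (σ : Store A) (a : A) (x : ℕ) (e : Exp)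
      (ρ' : PEnv A) (c : A) (b : A),
      IsValue v → σ a = some (Storable.kont (Kont.fn (Exp.lam x e) ρ' c)) → σ b = none →
      CeskStep ⟨v, ρ, σ, a⟩
        ⟨e, updA ρ' x b, Store.upd σ b (Storable.clo v ρ), c⟩

/-- The initial store `[a₀ ↦ mt]`. -/
def initStore {A : Type} [DecidableEq A] (a₀ : A) : Store A :=
  fun a => if a = a₀ then some (Storable.kont Kont.mt) else none

/-- Initial CESK* state. -/
def injCesk {A : Type} [DecidableEq A] (a₀ : A) (e : Exp) : CeskState A :=
  ⟨e, [], initStore a₀, a₀⟩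

/-- The `real` function of the CESK* machine: `RealP σ v ρ e'` means that
unfolding the delayed substitutions of `ρ` on `v`, following the
indirection through the store `σ`, yields `e'`. -/
inductive RealP {A : Type} (σ : Store A) : Exp → PEnv A → Exp → Prop where
  | varHit : ∀ (x : ℕ) (ρ : PEnv A) (l : A) (v : Exp) (ρ' : PEnv A) (e' : Exp),
      lookupA ρ x = some l → σ l = some (Storable.clo v ρ') →
      RealP σ v ρ' e' → RealP σ (Exp.var x) ρ e'
  | varMiss : ∀ (x : ℕ) (ρ : PEnv A),
      lookupA ρ x = none → RealP σ (Exp.var x) ρ (Exp.var x)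
  | app : ∀ (e₀ e₁ : Exp) (ρ : PEnv A) (e₀' e₁' : Exp),
      RealP σ e₀ ρ e₀' → RealP σ e₁ ρ e₁' →
      RealP σ (Exp.app e₀ e₁) ρ (Exp.app e₀' e₁')
  | lam : ∀ (x : ℕ) (b : Exp) (ρ : PEnv A) (b' : Exp),
      RealP σ b (eraseA ρ x) b' → RealP σ (Exp.lam x b) ρ (Exp.lam x b')

/-! ## Renaming of addresses -/

def renEnv {A B : Type} (f : A → B) (ρ : PEnv A) : PEnv B :=
  ρ.map (fun p => (p.1, f p.2))

def Kont.ren {A B : Type} (f : A → B) : Kont A → Kont B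
  | Kont.mt => Kont.mt
  | Kont.ar e ρ a => Kont.ar e (renEnv f ρ) (f a)
  | Kont.fn v ρ a => Kont.fn v (renEnv f ρ) (f a)

def Storable.ren {A B : Type} (f : A → B) : Storable A → Storable B
  | Storable.clo v ρ => Storable.clo v (renEnv f ρ)
  | Storable.kont κ => Storable.kont (Kont.ren f κ)

/-- Renaming a store along a bijection of addresses. -/
def Store.ren {A : Type} (π : A ≃ A) (σ : Store A) : Store A :=
  fun a => (σ (π.symm a)).map (Storable.ren π)

/-- A consistent renaming of addresses, applied uniformly throughout a state. -/
def CeskState.ren {A : Type} (π : A ≃ A) (ς : CeskState A) : CeskState A :=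
  ⟨ς.exp, renEnv π ς.env, Store.ren π ς.sto, π ς.kptr⟩

/-! ## The time-stamped CESK* machine -/

structure TState (A T : Type) : Type where
  exp : Exp
  env : PEnv A
  sto : Store A
  kptr : A
  time : T

/-- The time-stamped CESK* transition relation, parameterized by `alloc`
and `tick`. -/
inductive TStep {A T : Type} [DecidableEq A]
    (alloc : TState A T → A) (tick : TState A T → T) :
    TState A T → TState A T → Prop where
  | var : ∀ (x : ℕ) (ρ : PEnv A) (σ : Store A) (a : A) (t : T) (κ : Kont A)
      (l : A) (v : Exp) (ρ' : PEnv A),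
      σ a = some (Storable.kont κ) →
      lookupA ρ x = some l → σ l = some (Storable.clo v ρ') →
      TStep alloc tick ⟨Exp.var x, ρ, σ, a, t⟩
        ⟨v, ρ', σ, a, tick ⟨Exp.var x, ρ, σ, a, t⟩⟩
  | app : ∀ (e₀ e₁ : Exp) (ρ : PEnv A) (σ : Store A) (a : A) (t : T) (κ : Kont A),
      σ a = some (Storable.kont κ) →
      TStep alloc tick ⟨Exp.app e₀ e₁, ρ, σ, a, t⟩
        ⟨e₀, ρ,
         Store.upd σ (alloc ⟨Exp.app e₀ e₁, ρ, σ, a, t⟩)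
           (Storable.kont (Kont.ar e₁ ρ a)),
         alloc ⟨Exp.app e₀ e₁, ρ, σ, a, t⟩, tick ⟨Exp.app e₀ e₁, ρ, σ, a, t⟩⟩
  | ar : ∀ (v : Exp) (ρ : PEnv A) (σ : Store A) (a : A) (t : T) (e : Exp)
      (ρ' : PEnv A) (c : A),
      IsValue v → σ a = some (Storable.kont (Kont.ar e ρ' c)) →
      TStep alloc tick ⟨v, ρ, σ, a, t⟩
        ⟨e, ρ',
         Store.upd σ (alloc ⟨v, ρ, σ, a, t⟩) (Storable.kont (Kont.fn v ρ c)),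
         alloc ⟨v, ρ, σ, a, t⟩, tick ⟨v, ρ, σ, a, t⟩⟩
  | fn : ∀ (v : Exp) (ρ : PEnv A) (σ : Store A) (a : A) (t : T) (x : ℕ)
      (e : Exp) (ρ' : PEnv A) (c : A),
      IsValue v → σ a = some (Storable.kont (Kont.fn (Exp.lam x e) ρ' c)) →
      TStep alloc tick ⟨v, ρ, σ, a, t⟩
        ⟨e, updA ρ' x (alloc ⟨v, ρ, σ, a, t⟩),
         Store.upd σ (alloc ⟨v, ρ, σ, a, t⟩) (Storable.clo v ρ), c,
         tick ⟨v, ρ, σ, a, t⟩⟩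

/-- Initial time-stamped CESK* state. -/
def injT {A T : Type} [DecidableEq A] (a₀ : A) (t₀ : T) (e : Exp) : TState A T :=
  ⟨e, [], initStore a₀, a₀, t₀⟩

/-- Erasing the time stamp. -/
def eraseT {A T : Type} (ς : TState A T) : CeskState A :=
  ⟨ς.exp, ς.env, ς.sto, ς.kptr⟩

/-- Correspondence between time-stamped and plain CESK* states: equality
after erasing the time stamp, up to a consistent renaming of addresses. -/
def TCorr {A T : Type} (ς : TState A T) (ς' : CeskState A) : Prop :=
  ∃ π : A ≃ A, CeskState.ren π (eraseT ς) = ς'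

/-! ## The abstract time-stamped CESK* machine -/

/-- Abstract stores map addresses to *sets* of storables. -/
abbrev AStore (A : Type) : Type := A → Set (Storable A)

/-- Pointwise order on abstract stores. -/
def AStore.le {A : Type} (σ₁ σ₂ : AStore A) : Prop := ∀ a, σ₁ a ⊆ σ₂ a

/-- Store join `σ ⊔ [b ↦ s]`. -/
def AStore.join {A : Type} [DecidableEq A] (σ : AStore A) (b : A) (s : Storable A) :
    AStore A :=
  fun a => if a = b then insert s (σ a) else σ a

/-- Abstraction of a concrete store along an abstraction of addresses:
`α(σ) = λâ.⊔_{α(a)=â} {α(σ(a))}`. -/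
def absStore {A B : Type} (αA : A → B) (σ : Store A) : AStore B :=
  fun b => { s' | ∃ (a : A) (s : Storable A), αA a = b ∧ σ a = some s ∧ s' = Storable.ren αA s }

structure AState (A T : Type) : Type where
  exp : Exp
  env : PEnv A
  sto : AStore A
  kptr : A
  time : T

/-- Abstraction map on time-stamped states, acting componentwise. -/
def αTS {A T B S : Type} (αA : A → B) (αT : T → S) (ς : TState A T) : AState B S :=
  ⟨ς.exp, renEnv αA ς.env, absStore αA ς.sto, αA ς.kptr, αT ς.time⟩

/-- The order `⊑` on abstract states: pointwise/memberwise on stores, the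
given order on times, and flat (equality) on the other components. -/
def AState.le {A T : Type} [Preorder T] (ς₁ ς₂ : AState A T) : Prop :=
  ς₁.exp = ς₂.exp ∧ ς₁.env = ς₂.env ∧ AStore.le ς₁.sto ς₂.sto ∧
    ς₁.kptr = ς₂.kptr ∧ ς₁.time ≤ ς₂.time

/-- The abstract time-stamped CESK* transition relation, parameterized by
`alloĉ` and `tick̂` (which take the state together with the chosen
continuation `κ ∈ σ̂(a)`). -/
inductive AStep {A T : Type} [DecidableEq A]
    (allocA : AState A T → Kont A → A) (tickA : AState A T → Kont A → T) :
    AState A T → AState A T → Prop where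
  | var : ∀ (x : ℕ) (ρ : PEnv A) (σ : AStore A) (a : A) (t : T) (κ : Kont A)
      (l : A) (v : Exp) (ρ' : PEnv A),
      Storable.kont κ ∈ σ a → lookupA ρ x = some l →
      Storable.clo v ρ' ∈ σ l →
      AStep allocA tickA ⟨Exp.var x, ρ, σ, a, t⟩
        ⟨v, ρ', σ, a, tickA ⟨Exp.var x, ρ, σ, a, t⟩ κ⟩
  | app : ∀ (e₀ e₁ : Exp) (ρ : PEnv A) (σ : AStore A) (a : A) (t : T) (κ : Kont A),
      Storable.kont κ ∈ σ a →
      AStep allocA tickA ⟨Exp.app e₀ e₁, ρ, σ, a, t⟩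
        ⟨e₀, ρ,
         AStore.join σ (allocA ⟨Exp.app e₀ e₁, ρ, σ, a, t⟩ κ)
           (Storable.kont (Kont.ar e₁ ρ a)),
         allocA ⟨Exp.app e₀ e₁, ρ, σ, a, t⟩ κ,
         tickA ⟨Exp.app e₀ e₁, ρ, σ, a, t⟩ κ⟩
  | ar : ∀ (v : Exp) (ρ : PEnv A) (σ : AStore A) (a : A) (t : T) (e : Exp)
      (ρ' : PEnv A) (c : A),
      IsValue v → Storable.kont (Kont.ar e ρ' c) ∈ σ a →
      AStep allocA tickA ⟨v, ρ, σ, a, t⟩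
        ⟨e, ρ',
         AStore.join σ (allocA ⟨v, ρ, σ, a, t⟩ (Kont.ar e ρ' c))
           (Storable.kont (Kont.fn v ρ c)),
         allocA ⟨v, ρ, σ, a, t⟩ (Kont.ar e ρ' c),
         tickA ⟨v, ρ, σ, a, t⟩ (Kont.ar e ρ' c)⟩
  | fn : ∀ (v : Exp) (ρ : PEnv A) (σ : AStore A) (a : A) (t : T) (x : ℕ)
      (e : Exp) (ρ' : PEnv A) (c : A),
      IsValue v → Storable.kont (Kont.fn (Exp.lam x e) ρ' c) ∈ σ a →
      AStep allocA tickA ⟨v, ρ, σ, a, t⟩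
        ⟨e, updA ρ' x (allocA ⟨v, ρ, σ, a, t⟩ (Kont.fn (Exp.lam x e) ρ' c)),
         AStore.join σ (allocA ⟨v, ρ, σ, a, t⟩ (Kont.fn (Exp.lam x e) ρ' c))
           (Storable.clo v ρ),
         c, tickA ⟨v, ρ, σ, a, t⟩ (Kont.fn (Exp.lam x e) ρ' c)⟩

/-! ## Correspondence between CEK states and (time-stamped) CESK* states -/

/-- `EnvC σ ρp ρ`: the pointer environment `ρp` corresponds, through the
store `σ`, to the CEK environment `ρ`. -/
inductive EnvC {A : Type} (σ : Store A) : PEnv A → CEnv → Prop where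
  | nil : EnvC σ [] []
  | cons : ∀ (x : ℕ) (l : A) (v : Exp) (ρp' : PEnv A) (ρ' : CEnv)
      (ρp : PEnv A) (ρ : CEnv),
      σ l = some (Storable.clo v ρp') → EnvC σ ρp' ρ' → EnvC σ ρp ρ →
      EnvC σ ((x, l) :: ρp) ((x, Clo.mk v ρ') :: ρ)

/-- `KontC σ a κ`: the continuation pointer `a` corresponds, through the
store `σ`, to the CEK continuation `κ`. -/
inductive KontC {A : Type} (σ : Store A) : A → CKont → Prop where
  | mt : ∀ (a : A), σ a = some (Storable.kont Kont.mt) → KontC σ a CKont.mt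
  | ar : ∀ (a : A) (e : Exp) (ρp : PEnv A) (c : A) (ρ : CEnv) (κ : CKont),
      σ a = some (Storable.kont (Kont.ar e ρp c)) →
      EnvC σ ρp ρ → KontC σ c κ → KontC σ a (CKont.ar e ρ κ)
  | fn : ∀ (a : A) (v : Exp) (ρp : PEnv A) (c : A) (ρ : CEnv) (κ : CKont),
      σ a = some (Storable.kont (Kont.fn v ρp c)) →
      EnvC σ ρp ρ → KontC σ c κ → KontC σ a (CKont.fn v ρ κ)

/-- The lock-step correspondence between a CEK state and a time-stamped
CESK* state. -/
def StateC {A T : Type} (ς : CEKState) (ςt : TState A T) : Prop :=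
  ς.exp = ςt.exp ∧ EnvC ςt.sto ςt.env ς.env ∧ KontC ςt.sto ςt.kptr ς.kont

/-! ## Well-formed abstract states over a program (for finiteness) -/

def WFEnv {A : Type} (e : Exp) (ρ : PEnv A) : Prop :=
  (ρ.map Prod.fst).Nodup ∧ ∀ p ∈ ρ, p.1 ∈ vars e

def WFKont {A : Type} (e : Exp) : Kont A → Prop
  | Kont.mt => True
  | Kont.ar e' ρ _ => e' ∈ subExps e ∧ WFEnv e ρ
  | Kont.fn v ρ _ => v ∈ subExps e ∧ WFEnv e ρ

def WFStorable {A : Type} (e : Exp) : Storable A → Prop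
  | Storable.clo v ρ => v ∈ subExps e ∧ WFEnv e ρ
  | Storable.kont κ => WFKont e κ

/-- Abstract states all of whose components are built from the (finitely
many) subexpressions and variables of the program `e`. -/
def WFState {A T : Type} (e : Exp) (ς : AState A T) : Prop :=
  ς.exp ∈ subExps e ∧ WFEnv e ς.env ∧
    ∀ (a : A) (s : Storable A), s ∈ ς.sto a → WFStorable e s

/-- The abstraction of the initial time-stamped CESK* state, as an
abstract state. -/
def injA {A T : Type} [DecidableEq A] (a₀ : A) (t₀ : T) (e : Exp) : AState A T :=
  ⟨e, [], fun a => if a = a₀ then {Storable.kont Kont.mt} else ∅, a₀, t₀⟩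

/-! ## Garbage collection -/

/-- `envLive ρ e` : the range of `ρ` restricted to the free variables of
`e` — the live locations `L_σ(e,ρ)` contributed by a closure. -/
def envLive {A : Type} (ρ : PEnv A) (e : Exp) : Set A :=
  { l | ∃ x ∈ fv e, lookupA ρ x = some l }

/-- `LiveIn σ s l` : the address `l` is among the live locations
`L_σ(s)` of the storable `s` (least fixed point). -/
inductive LiveIn {A : Type} (σ : Store A) : Storable A → A → Prop where
  | clo : ∀ (v : Exp) (ρ : PEnv A) (l : A),
      l ∈ envLive ρ v → LiveIn σ (Storable.clo v ρ) l
  | arSelf : ∀ (e : Exp) (ρ : PEnv A) (a : A),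
      LiveIn σ (Storable.kont (Kont.ar e ρ a)) a
  | arEnv : ∀ (e : Exp) (ρ : PEnv A) (a : A) (l : A),
      l ∈ envLive ρ e → LiveIn σ (Storable.kont (Kont.ar e ρ a)) l
  | arRec : ∀ (e : Exp) (ρ : PEnv A) (a : A) (s : Storable A) (l : A),
      σ a = some s → LiveIn σ s l → LiveIn σ (Storable.kont (Kont.ar e ρ a)) l
  | fnSelf : ∀ (v : Exp) (ρ : PEnv A) (a : A),
      LiveIn σ (Storable.kont (Kont.fn v ρ a)) a
  | fnEnv : ∀ (v : Exp) (ρ : PEnv A) (a : A) (l : A),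
      l ∈ envLive ρ v → LiveIn σ (Storable.kont (Kont.fn v ρ a)) l
  | fnRec : ∀ (v : Exp) (ρ : PEnv A) (a : A) (s : Storable A) (l : A),
      σ a = some s → LiveIn σ s l → LiveIn σ (Storable.kont (Kont.fn v ρ a)) l

/-- `L_σ(σ(a))`, the live locations of the storable at address `a`. -/
def liveOfAddr {A : Type} (σ : Store A) (a : A) : Set A :=
  { l | ∃ s : Storable A, σ a = some s ∧ LiveIn σ s l }

/-- States of the GC machine: grey locations, black locations, store. -/
structure GCState (A : Type) : Type where
  grey : Set A
  black : Set A
  sto : Store A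

/-- The GC machine transition. -/
inductive GCStep {A : Type} : GCState A → GCState A → Prop where
  | mk : ∀ (G B : Set A) (σ : Store A) (a : A),
      a ∈ G →
      GCStep ⟨G, B, σ⟩ ⟨(G ∪ liveOfAddr σ a) \ (insert a B), insert a B, σ⟩

/-- The set of store locations reachable from the initial grey set `G₀`:
the least set containing `G₀` and closed under `a ↦ L_σ(σ(a))`. -/
inductive ReachAddr {A : Type} (σ : Store A) (G₀ : Set A) : A → Prop where
  | base : ∀ (a : A), a ∈ G₀ → ReachAddr σ G₀ a
  | step : ∀ (a l : A), ReachAddr σ G₀ a → l ∈ liveOfAddr σ a → ReachAddr σ G₀ l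

-- Restriction of a store to a set of live locations.
open Classical in
noncomputable def Store.restrict {A : Type} (σ : Store A) (L : Set A) : Store A :=
  fun l => if l ∈ L then σ l else none

/-- The GC transition of the CESK* machine. -/
inductive CGCTrans {A : Type} : CeskState A → CeskState A → Prop where
  | mk : ∀ (e : Exp) (ρ : PEnv A) (σ : Store A) (a : A) (L : Set A),
      Relation.ReflTransGen GCStep
        ⟨envLive ρ e ∪ liveOfAddr σ a, {a}, σ⟩ ⟨∅, L, σ⟩ →
      CGCTrans ⟨e, ρ, σ, a⟩ ⟨e, ρ, Store.restrict σ L, a⟩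

/-! ### Abstract garbage collection -/

/-- Live locations of an abstract storable in an abstract store (with the
live-location function extended to the sets of storables stored at an
address by taking unions). -/
inductive ALiveIn {A : Type} (σ : AStore A) : Storable A → A → Prop where
  | clo : ∀ (v : Exp) (ρ : PEnv A) (l : A),
      l ∈ envLive ρ v → ALiveIn σ (Storable.clo v ρ) l
  | arSelf : ∀ (e : Exp) (ρ : PEnv A) (a : A),
      ALiveIn σ (Storable.kont (Kont.ar e ρ a)) a
  | arEnv : ∀ (e : Exp) (ρ : PEnv A) (a : A) (l : A),
      l ∈ envLive ρ e → ALiveIn σ (Storable.kont (Kont.ar e ρ a)) l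
  | arRec : ∀ (e : Exp) (ρ : PEnv A) (a : A) (s : Storable A) (l : A),
      s ∈ σ a → ALiveIn σ s l → ALiveIn σ (Storable.kont (Kont.ar e ρ a)) l
  | fnSelf : ∀ (v : Exp) (ρ : PEnv A) (a : A),
      ALiveIn σ (Storable.kont (Kont.fn v ρ a)) a
  | fnEnv : ∀ (v : Exp) (ρ : PEnv A) (a : A) (l : A),
      l ∈ envLive ρ v → ALiveIn σ (Storable.kont (Kont.fn v ρ a)) l
  | fnRec : ∀ (v : Exp) (ρ : PEnv A) (a : A) (s : Storable A) (l : A),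
      s ∈ σ a → ALiveIn σ s l → ALiveIn σ (Storable.kont (Kont.fn v ρ a)) l

/-- `L_σ̂(σ̂(â))`, the live locations of the set of storables at `â`. -/
def aliveOfAddr {A : Type} (σ : AStore A) (a : A) : Set A :=
  { l | ∃ s ∈ σ a, ALiveIn σ s l }

structure AGCState (A : Type) : Type where
  grey : Set A
  black : Set A
  sto : AStore A

inductive AGCStep {A : Type} : AGCState A → AGCState A → Prop where
  | mk : ∀ (G B : Set A) (σ : AStore A) (a : A),
      a ∈ G →
      AGCStep ⟨G, B, σ⟩ ⟨(G ∪ aliveOfAddr σ a) \ (insert a B), insert a B, σ⟩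

-- Restriction of an abstract store to a set of live locations.
open Classical in
noncomputable def AStore.restrict {A : Type} (σ : AStore A) (L : Set A) : AStore A :=
  fun l => if l ∈ L then σ l else ∅

/-- Abstract CESK* states (no time stamps), for abstract GC. -/
structure ACeskState (A : Type) : Type where
  exp : Exp
  env : PEnv A
  sto : AStore A
  kptr : A

/-- Abstraction map on CESK* states. -/
def αCS {A B : Type} (αA : A → B) (ς : CeskState A) : ACeskState B :=
  ⟨ς.exp, renEnv αA ς.env, absStore αA ς.sto, αA ς.kptr⟩

def ACeskState.le {A : Type} (ς₁ ς₂ : ACeskState A) : Prop :=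
  ς₁.exp = ς₂.exp ∧ ς₁.env = ς₂.env ∧ AStore.le ς₁.sto ς₂.sto ∧ ς₁.kptr = ς₂.kptr

/-- The abstract GC transition. -/
inductive AGCTrans {A : Type} : ACeskState A → ACeskState A → Prop where
  | mk : ∀ (e : Exp) (ρ : PEnv A) (σ : AStore A) (a : A) (L : Set A),
      Relation.ReflTransGen AGCStep
        ⟨envLive ρ e ∪ aliveOfAddr σ a, {a}, σ⟩ ⟨∅, L, σ⟩ →
      AGCTrans ⟨e, ρ, σ, a⟩ ⟨e, ρ, AStore.restrict σ L, a⟩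

/-- Every standard step is either a root `β_v`-contraction or a step in one side of an application,
where a step on the right requires the left side to be a value. -/
theorem StdStep.cases_app {e e' : Exp} (h : StdStep e e') :
    (∃ x b v, IsValue v ∧ e = Exp.app (Exp.lam x b) v ∧ e' = subst v x b) ∨
    (∃ f f' a, StdStep f f' ∧ e = Exp.app f a ∧ e' = Exp.app f' a) ∨
    (∃ v a a', IsValue v ∧ StdStep a a' ∧ e = Exp.app v a ∧ e' = Exp.app v a') := by
  obtain ⟨E, x, b, v, hE, hv⟩ := h
  cases hE with
  | hole => exact Or.inl ⟨x, b, v, hv, rfl, rfl⟩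
  | appL E a hE => exact Or.inr (Or.inl ⟨_, _, a, StdStep.mk E x b v hE hv, rfl, rfl⟩)
  | appR w E hw hE => exact Or.inr (Or.inr ⟨w, _, _, hw, StdStep.mk E x b v hE hv, rfl, rfl⟩)

/-- Values are irreducible. -/
theorem IsValue.not_stdStep {v e : Exp} (hv : IsValue v) : ¬ StdStep v e := by
  obtain ⟨x, b, rfl⟩ := hv
  intro h
  rcases h.cases_app with ⟨_, _, _, _, h, _⟩ | ⟨_, _, _, _, h, _⟩ | ⟨_, _, _, _, _, h, _⟩ <;> cases h

/-- Standard reduction is deterministic. -/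
theorem StdStep.deterministic {e e₁ e₂ : Exp} (h₁ : StdStep e e₁) (h₂ : StdStep e e₂) :
    e₁ = e₂ := by
  induction e generalizing e₁ e₂ with
  | var | lam =>
    rcases h₁.cases_app with ⟨_, _, _, _, h, _⟩ | ⟨_, _, _, _, h, _⟩ | ⟨_, _, _, _, _, h, _⟩ <;>
      cases h
  | app f a ihf iha =>
    rcases h₁.cases_app with ⟨x, b, v, hv, h, rfl⟩ | ⟨_, f₁, _, hs, h, rfl⟩ |
        ⟨_, _, a₁, hv, hs, h, rfl⟩ <;> cases h <;>
      rcases h₂.cases_app with ⟨y, c, w, hw, h, rfl⟩ | ⟨_, f₂, _, ht, h, rfl⟩ |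
        ⟨_, _, a₂, hw, ht, h, rfl⟩ <;> cases h
    · rfl
    · exact absurd ht (IsValue.not_stdStep ⟨x, b, rfl⟩)
    · exact absurd ht hv.not_stdStep
    · exact absurd hs (IsValue.not_stdStep ⟨y, c, rfl⟩)
    · rw [ihf hs ht]
    · exact absurd hs hw.not_stdStep
    · exact absurd hs hw.not_stdStep
    · exact absurd ht hv.not_stdStep
    · rw [iha hs ht]

/-- A value reduces, in any number of standard steps, only to itself. -/
theorem IsValue.eq_of_reflTransGen {v e : Exp} (hv : IsValue v)
    (h : Relation.ReflTransGen StdStep v e) : v = e := by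
  rcases h.cases_head with h | ⟨_, hs, _⟩
  · exact h
  · exact absurd hs hv.not_stdStep

/-- The evaluation function is a well-defined partial
function: if a program reduces (by the reflexive-transitive closure of
standard reduction) to values `v₁` and `v₂`, then `v₁ = v₂`. -/
theorem eval_well_defined (e v₁ v₂ : Exp) (he : Closed e)
    (hv₁ : IsValue v₁) (hv₂ : IsValue v₂)
    (h₁ : Relation.ReflTransGen StdStep e v₁)
    (h₂ : Relation.ReflTransGen StdStep e v₂) : v₁ = v₂ := by
  rcases Relation.ReflTransGen.total_of_right_unique (r := StdStep)
    (fun _ _ _ => StdStep.deterministic) h₁ h₂ with h | h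
  · exact hv₁.eq_of_reflTransGen h
  · exact (hv₂.eq_of_reflTransGen h).symm
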